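/- Let P be a poset on [p] such that both P and its complement poset P̄ = {[p] \ F : F ∈ P} have legs, and let n ≥ 3. Then every induced P-saturated family F ⊆ 2^{[n]} satisfies |F| ≥ 2n + 2. -/

import Mathlib

/-- `φ` is an induced-copy map of the poset `P` into the family `F`
(posets are finite collections of finite subsets of `ℕ`, ordered by inclusion). -/
def IsCopyMap (P F : Finset (Finset ℕ)) (φ : Finset ℕ → Finset ℕ) : Prop :=
  Set.InjOn φ ↑P ∧ (∀ A ∈ P, φ A ∈ F) ∧ ∀ A ∈ P, ∀ B ∈ P, (φ A ⊆ φ B ↔ A ⊆ B)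

/-- `F` contains an induced copy of the poset `P`. -/
def ContainsInduced (P F : Finset (Finset ℕ)) : Prop := ∃ φ, IsCopyMap P F φ

/-- `F ⊆ 2^[n]` is induced `P`-saturated. -/
def InducedSaturated (n : ℕ) (P F : Finset (Finset ℕ)) : Prop :=
  (∀ A ∈ F, A ⊆ Finset.Icc 1 n) ∧ ¬ ContainsInduced P F ∧
  ∀ S ⊆ Finset.Icc 1 n, S ∉ F → ContainsInduced P (insert S F)

/-- `P` has legs `L1, L2` and hip `H`. -/
def LegsAt (P : Finset (Finset ℕ)) (L1 L2 H : Finset ℕ) : Prop :=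
  L1 ∈ P ∧ L2 ∈ P ∧ H ∈ P ∧ L1 ≠ L2 ∧ L1 ≠ H ∧ L2 ≠ H ∧
  ¬ L1 ⊆ L2 ∧ ¬ L2 ⊆ L1 ∧ L1 ⊆ H ∧ L2 ⊆ H ∧
  ∀ A ∈ P, A ≠ L1 → A ≠ L2 → A ≠ H → H ⊆ A

/-- `P` has legs. -/
def HasLegs (P : Finset (Finset ℕ)) : Prop := ∃ L1 L2 H, LegsAt P L1 L2 H

/-- `sat*(n, P)`: the minimum size of an induced `P`-saturated family in `2^[n]`. -/
noncomputable def satStar (n : ℕ) (P : Finset (Finset ℕ)) : ℕ :=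
  sInf {k | ∃ F : Finset (Finset ℕ), InducedSaturated n P F ∧ F.card = k}

/-- The subset of `P` without its legs embeds in `F` above `X`. -/
def GoodBelow (P F : Finset (Finset ℕ)) (L1 L2 H X : Finset ℕ) : Prop :=
  ∃ φ : Finset ℕ → Finset ℕ, (∀ A ∈ P, A ≠ L1 → A ≠ L2 → φ A ∈ F) ∧
    (∀ A ∈ P, A ≠ L1 → A ≠ L2 → ∀ B ∈ P, B ≠ L1 → B ≠ L2 → (φ A ⊆ φ B ↔ A ⊆ B)) ∧ X ⊆ φ H

theorem card_of_labels (I : Finset ℕ) : ∀ G : Finset (Finset ℕ), G.Nonempty →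
    (∀ i ∈ I, ∃ A ∈ G, i ∉ A ∧ insert i A ∈ G) → I.card + 1 ≤ G.card := by
  induction I using Finset.induction_on with
  | empty => intro G hG _; simpa using hG
  | insert a I ha ih =>
    intro G hG h
    rw [Finset.card_insert_of_notMem ha]
    have h1 := ih (G.image fun A => A.erase a) (hG.image _) (by
      intro i hi
      obtain ⟨A, hA, hiA, hiA'⟩ := h i (Finset.mem_insert_of_mem hi)
      have hne : i ≠ a := fun h => ha (h ▸ hi)
      refine ⟨A.erase a, Finset.mem_image_of_mem _ hA, ?_, ?_⟩
      · simp [hiA]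
      · rw [Finset.mem_image]
        exact ⟨_, hiA', Finset.erase_insert_of_ne hne⟩)
    obtain ⟨A, hA, haA, haA'⟩ := h a (Finset.mem_insert_self _ _)
    have h2 : (G.image fun A => A.erase a).card < G.card := by
      refine lt_of_le_of_ne Finset.card_image_le ?_
      intro he
      have := Finset.card_image_iff.mp he
      have h3 : A = insert a A := this hA haA' (by simp [haA])
      exact haA (h3 ▸ Finset.mem_insert_self a A)
    omega

theorem hip_le {P : Finset (Finset ℕ)} {L1 L2 H A : Finset ℕ} (hL : LegsAt P L1 L2 H)
    (hA : A ∈ P) (h1 : A ≠ L1) (h2 : A ≠ L2) : H ⊆ A := by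
  obtain ⟨_, _, _, _, _, _, _, _, _, _, h⟩ := hL
  by_cases hh : A = H
  · exact hh ▸ subset_rfl
  · exact h A hA h1 h2 hh

theorem good_chain {P F : Finset (Finset ℕ)} {L1 L2 H X Y1 Y2 : Finset ℕ}
    (hL : LegsAt P L1 L2 H) (hF : ¬ ContainsInduced P F) (hX : GoodBelow P F L1 L2 H X)
    (hY1 : Y1 ∈ F) (hY2 : Y2 ∈ F) (h1 : Y1 ⊆ X) (h2 : Y2 ⊆ X) : Y1 ⊆ Y2 ∨ Y2 ⊆ Y1 := by
  by_contra hc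
  push Not at hc
  obtain ⟨hc1, hc2⟩ := hc
  obtain ⟨φ, hφF, hφ, hXH⟩ := hX
  have hip := fun A hA => @hip_le P L1 L2 H A hL hA
  obtain ⟨m1, m2, mH, n12, n1H, n2H, s12, s21, s1H, s2H, -⟩ := hL
  apply hF
  have key : ∀ A ∈ P, ∀ B ∈ P,
      ((if A = L1 then Y1 else if A = L2 then Y2 else φ A) ⊆
        (if B = L1 then Y1 else if B = L2 then Y2 else φ B) ↔ A ⊆ B) := by
    have up : ∀ B ∈ P, B ≠ L1 → B ≠ L2 → X ⊆ φ B := fun B hB b1 b2 =>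
      hXH.trans ((hφ H mH n1H.symm n2H.symm B hB b1 b2).2 (hip B hB b1 b2))
    intro A hA B hB
    by_cases a1 : A = L1
    · by_cases b1 : B = L1
      · simp [a1, b1]
      · by_cases b2 : B = L2
        · subst a1 b2; simp [b1, hc1, s12]
        · subst a1
          simp only [if_true, b1, b2, if_false]
          exact ⟨fun _ => s1H.trans (hip B hB b1 b2), fun _ => h1.trans (up B hB b1 b2)⟩
    · by_cases a2 : A = L2
      · by_cases b1 : B = L1
        · subst a2 b1; simp [a1, hc2, s21]
        · by_cases b2 : B = L2
          · simp [a2, b2]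
          · subst a2
            simp only [if_true, a1, b1, b2, if_false]
            exact ⟨fun _ => s2H.trans (hip B hB b1 b2), fun _ => h2.trans (up B hB b1 b2)⟩
      · by_cases b1 : B = L1
        · subst b1
          simp only [if_true, a1, a2, if_false]
          exact ⟨fun h => absurd (h2.trans ((up A hA a1 a2).trans h)) hc2,
            fun h => absurd (s2H.trans ((hip A hA a1 a2).trans h)) s21⟩
        · by_cases b2 : B = L2
          · subst b2
            simp only [if_true, a1, a2, b1, if_false]
            exact ⟨fun h => absurd (h1.trans ((up A hA a1 a2).trans h)) hc1,
              fun h => absurd (s1H.trans ((hip A hA a1 a2).trans h)) s12⟩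
          · simp only [a1, a2, b1, b2, if_false]
            exact hφ A hA a1 a2 B hB b1 b2
  refine ⟨fun A => if A = L1 then Y1 else if A = L2 then Y2 else φ A, ?_, ?_, key⟩
  · intro A hA B hB h
    exact Finset.Subset.antisymm ((key A hA B hB).1 (le_of_eq h))
      ((key B hB A hA).1 (le_of_eq h.symm))
  · intro A hA
    by_cases a1 : A = L1
    · simp [a1, hY1]
    · by_cases a2 : A = L2
      · simp only [a1, a2, if_true, if_false]
        split_ifs <;> assumption
      · simp only [a1, a2, if_false]
        exact hφF A hA a1 a2

theorem sat_extract {P F : Finset (Finset ℕ)} {L1 L2 H S : Finset ℕ} {n : ℕ}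
    (hL : LegsAt P L1 L2 H) (hF : InducedSaturated n P F) (hS : S ⊆ Finset.Icc 1 n)
    (hSF : S ∉ F) :
    (∃ Y1 ∈ F, ∃ Y2 ∈ F, Y1 ⊆ S ∧ Y2 ⊆ S ∧ ¬ Y1 ⊆ Y2 ∧ ¬ Y2 ⊆ Y1) ∨
    (∃ C ∈ F, ∃ X ∈ F, GoodBelow P F L1 L2 H X ∧ S ⊆ X ∧ C ⊆ X ∧ ¬ C ⊆ S ∧ ¬ S ⊆ C) := by
  obtain ⟨φ, hinj, hmem, hord⟩ := hF.2.2 S hS hSF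
  have hip := fun A hA => @hip_le P L1 L2 H A hL hA
  obtain ⟨m1, m2, mH, n12, n1H, n2H, s12, s21, s1H, s2H, -⟩ := hL
  have hex : ∃ A ∈ P, φ A = S := by
    by_contra hc
    push Not at hc
    exact hF.2.1 ⟨φ, hinj, fun A hA => Finset.mem_of_mem_insert_of_ne (hmem A hA) (hc A hA), hord⟩
  obtain ⟨A, hA, rfl⟩ := hex
  have hin : ∀ B ∈ P, B ≠ A → φ B ∈ F := fun B hB hne =>
    Finset.mem_of_mem_insert_of_ne (hmem B hB) (fun h => hne (hinj hB hA h))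
  by_cases a1 : A = L1
  · subst a1
    right
    exact ⟨φ L2, hin _ m2 n12.symm, φ H, hin _ mH n1H.symm,
      ⟨φ, fun B hB b1 _ => hin B hB b1, fun B hB _ _ C hC _ _ => hord B hB C hC, subset_rfl⟩,
      (hord _ hA _ mH).2 s1H, (hord _ m2 _ mH).2 s2H, fun h => s21 ((hord _ m2 _ hA).1 h),
      fun h => s12 ((hord _ hA _ m2).1 h)⟩
  · by_cases a2 : A = L2
    · subst a2
      right
      exact ⟨φ L1, hin _ m1 n12, φ H, hin _ mH n2H.symm,
        ⟨φ, fun B hB _ b2 => hin B hB b2, fun B hB _ _ C hC _ _ => hord B hB C hC, subset_rfl⟩,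
        (hord _ hA _ mH).2 s2H, (hord _ m1 _ mH).2 s1H, fun h => s12 ((hord _ m1 _ hA).1 h),
        fun h => s21 ((hord _ hA _ m1).1 h)⟩
    · left
      have := hip A hA a1 a2
      exact ⟨φ L1, hin _ m1 (Ne.symm a1), φ L2, hin _ m2 (Ne.symm a2),
        (hord _ m1 _ hA).2 (s1H.trans this), (hord _ m2 _ hA).2 (s2H.trans this),
        fun h => s12 ((hord _ m1 _ m2).1 h), fun h => s21 ((hord _ m2 _ m1).1 h)⟩

theorem GoodBelow.mono {P F : Finset (Finset ℕ)} {L1 L2 H X Y : Finset ℕ}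
    (hX : GoodBelow P F L1 L2 H X) (h : Y ⊆ X) : GoodBelow P F L1 L2 H Y := by
  obtain ⟨φ, h1, h2, h3⟩ := hX
  exact ⟨φ, h1, h2, h.trans h3⟩

theorem find_pair {P F : Finset (Finset ℕ)} {L1 L2 H : Finset ℕ} {n : ℕ}
    (hL : LegsAt P L1 L2 H) (hF : InducedSaturated n P F) (i : ℕ) (k : ℕ) :
    ∀ C ∈ F, ∀ X ∈ F, GoodBelow P F L1 L2 H X → C ⊆ X → i ∉ C → i ∈ X → n - C.card ≤ k →
    ∃ A ∈ F, i ∉ A ∧ insert i A ∈ F ∧ GoodBelow P F L1 L2 H (insert i A) := by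
  induction k with
  | zero =>
    intro C hC X hX hg hCX hiC hiX hk
    exfalso
    have h1 := Finset.card_lt_card (Finset.ssubset_iff_subset_ne.2
      ⟨hCX, fun h => hiC (h ▸ hiX)⟩)
    have h2 := Finset.card_le_card (hF.1 X hX)
    simp at h2
    omega
  | succ k ih =>
    intro C hC X hX hg hCX hiC hiX hk
    have hSX : insert i C ⊆ X := Finset.insert_subset hiX hCX
    by_cases hS : insert i C ∈ F
    · exact ⟨C, hC, hiC, hS, hg.mono hSX⟩
    · rcases sat_extract hL hF (hSX.trans (hF.1 X hX)) hS with
        ⟨Y1, hY1, Y2, hY2, s1, s2, n1, n2⟩ | ⟨C', hC', X', hX', hg', hSX', hCX', n1, n2⟩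
      · rcases good_chain hL hF.2.1 hg hY1 hY2 (s1.trans hSX) (s2.trans hSX) with h | h
        · exact absurd h n1
        · exact absurd h n2
      · have hsub := Finset.subset_insert i C
        have hCC : C ⊆ C' := by
          rcases good_chain hL hF.2.1 hg' hC hC' (hsub.trans hSX') hCX' with h | h
          · exact h
          · exact absurd (h.trans hsub) n1
        have hlt : C.card < C'.card := Finset.card_lt_card (Finset.ssubset_iff_subset_ne.2
          ⟨hCC, fun h => n1 (h ▸ hsub)⟩)
        exact ih C' hC' X' hX' hg' hCX' (fun h => n2 (Finset.insert_subset h hCC))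
          (hSX' (Finset.mem_insert_self _ _)) (by omega)

theorem chain_of_card_le_one {X Y1 Y2 : Finset ℕ} (hX : X.card ≤ 1) (h1 : Y1 ⊆ X)
    (h2 : Y2 ⊆ X) : Y1 ⊆ Y2 ∨ Y2 ⊆ Y1 := by
  by_cases h : Y1 = ∅
  · left; simp [h]
  · right
    have : Y1 = X := Finset.eq_of_subset_of_card_le h1
      (hX.trans (Finset.card_pos.2 (Finset.nonempty_iff_ne_empty.2 h)))
    rw [this]; exact h2

theorem half_bound {P F : Finset (Finset ℕ)} {L1 L2 H M1 M2 : Finset ℕ} {n : ℕ}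
    (hL : LegsAt P L1 L2 H) (hF : InducedSaturated n P F)
    (hM1 : M1 ∈ P) (hM2 : M2 ∈ P) (h11 : M1 ≠ L1) (h12 : M1 ≠ L2) (h21 : M2 ≠ L1)
    (h22 : M2 ≠ L2) (i1 : ¬ M1 ⊆ M2) (i2 : ¬ M2 ⊆ M1) :
    ∃ G ⊆ F, n + 1 ≤ G.card ∧ ∀ X ∈ G,
      (∀ Y1 ∈ F, ∀ Y2 ∈ F, Y1 ⊆ X → Y2 ⊆ X → Y1 ⊆ Y2 ∨ Y2 ⊆ Y1) ∧
      (X.card ≤ 1 ∨ ∃ Y1 ∈ F, ∃ Y2 ∈ F, X ⊆ Y1 ∧ X ⊆ Y2 ∧ ¬ Y1 ⊆ Y2 ∧ ¬ Y2 ⊆ Y1) := by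
  classical
  have hempty : (∅ : Finset ℕ) ∈ F := by
    by_contra hc
    rcases sat_extract hL hF (Finset.empty_subset _) hc with
      ⟨Y1, hY1, Y2, hY2, s1, s2, n1, n2⟩ | ⟨C', hC', X', hX', hg', hSX', hCX', n1, n2⟩
    · exact n1 (s1.trans (Finset.empty_subset _))
    · exact n2 (Finset.empty_subset _)
  refine ⟨F.filter fun X => X.card ≤ 1 ∨ GoodBelow P F L1 L2 H X, Finset.filter_subset _ _,
    ?_, ?_⟩
  · have := card_of_labels (Finset.Icc 1 n)
      (F.filter fun X => X.card ≤ 1 ∨ GoodBelow P F L1 L2 H X)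
      ⟨∅, by simp [hempty]⟩ ?_
    · simpa using this
    · intro i hi
      by_cases hs : {i} ∈ F
      · exact ⟨∅, by simp [hempty], by simp, by simp [hs]⟩
      · rcases sat_extract hL hF (Finset.singleton_subset_iff.2 hi) hs with
          ⟨Y1, hY1, Y2, hY2, s1, s2, n1, n2⟩ | ⟨C, hC, X, hX, hg, hSX, hCX, n1, n2⟩
        · rcases chain_of_card_le_one (by simp) s1 s2 with h | h
          · exact absurd h n1
          · exact absurd h n2
        · obtain ⟨A, hA, hiA, hiA', hgA⟩ := find_pair hL hF i _ C hC X hX hg hCX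
            (fun h => n2 (Finset.singleton_subset_iff.2 h)) (Finset.singleton_subset_iff.1 hSX)
            le_rfl
          exact ⟨A, Finset.mem_filter.2 ⟨hA, Or.inr (hgA.mono (Finset.subset_insert _ _))⟩, hiA,
            Finset.mem_filter.2 ⟨hiA', Or.inr hgA⟩⟩
  · intro X hX
    obtain ⟨hXF, hX⟩ := Finset.mem_filter.1 hX
    rcases hX with hX | hX
    · exact ⟨fun Y1 _ Y2 _ s1 s2 => chain_of_card_le_one hX s1 s2, Or.inl hX⟩
    · refine ⟨fun Y1 hY1 Y2 hY2 s1 s2 => good_chain hL hF.2.1 hX hY1 hY2 s1 s2, Or.inr ?_⟩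
      obtain ⟨φ, hφF, hφ, hXH⟩ := hX
      have mH : H ∈ P := hL.2.2.1
      have n1 : H ≠ L1 := hL.2.2.2.2.1.symm
      have n2 : H ≠ L2 := hL.2.2.2.2.2.1.symm
      refine ⟨φ M1, hφF _ hM1 h11 h12, φ M2, hφF _ hM2 h21 h22, ?_, ?_, ?_, ?_⟩
      · exact hXH.trans ((hφ _ mH n1 n2 _ hM1 h11 h12).2 (hip_le hL hM1 h11 h12))
      · exact hXH.trans ((hφ _ mH n1 n2 _ hM2 h21 h22).2 (hip_le hL hM2 h21 h22))
      · exact fun h => i1 ((hφ _ hM1 h11 h12 _ hM2 h21 h22).1 h)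
      · exact fun h => i2 ((hφ _ hM2 h21 h22 _ hM1 h11 h12).1 h)

theorem compl_sub_iff {U A B : Finset ℕ} (hA : A ⊆ U) : U \ B ⊆ U \ A ↔ A ⊆ B := by
  constructor
  · intro h x hx
    by_contra hb
    have := h (Finset.mem_sdiff.2 ⟨hA hx, hb⟩)
    exact (Finset.mem_sdiff.1 this).2 hx
  · intro h
    exact Finset.sdiff_subset_sdiff subset_rfl h

theorem compl_image_image {U : Finset ℕ} {P : Finset (Finset ℕ)} (hP : ∀ A ∈ P, A ⊆ U) :
    (P.image fun A => U \ A).image (fun A => U \ A) = P := by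
  rw [Finset.image_image]
  ext A
  simp only [Finset.mem_image, Function.comp]
  constructor
  · rintro ⟨B, hB, rfl⟩
    rwa [Finset.sdiff_sdiff_eq_self (hP B hB)]
  · intro hA
    exact ⟨A, hA, Finset.sdiff_sdiff_eq_self (hP A hA)⟩

theorem contains_compl {U V : Finset ℕ} {P F : Finset (Finset ℕ)} (hP : ∀ A ∈ P, A ⊆ U)
    (hF : ∀ A ∈ F, A ⊆ V) (h : ContainsInduced P F) :
    ContainsInduced (P.image fun A => U \ A) (F.image fun A => V \ A) := by
  obtain ⟨φ, hinj, hmem, hord⟩ := h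
  have key : ∀ A ∈ P.image (fun A => U \ A), ∀ B ∈ P.image (fun A => U \ A),
      (V \ φ (U \ A) ⊆ V \ φ (U \ B) ↔ A ⊆ B) := by
    intro A hA B hB
    obtain ⟨A, hA', rfl⟩ := Finset.mem_image.1 hA
    obtain ⟨B, hB', rfl⟩ := Finset.mem_image.1 hB
    simp only [Finset.sdiff_sdiff_eq_self (hP A hA'), Finset.sdiff_sdiff_eq_self (hP B hB')]
    rw [compl_sub_iff (hF _ (hmem B hB')), compl_sub_iff (hP B hB'), hord B hB' A hA']
  refine ⟨fun A => V \ φ (U \ A), ?_, ?_, key⟩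
  · intro A hA B hB h
    exact Finset.Subset.antisymm ((key A hA B hB).1 (le_of_eq h))
      ((key B hB A hA).1 (le_of_eq h.symm))
  · intro A hA
    obtain ⟨A, hA', rfl⟩ := Finset.mem_image.1 hA
    simp only [Finset.sdiff_sdiff_eq_self (hP A hA')]
    exact Finset.mem_image_of_mem _ (hmem A hA')

theorem saturated_compl {p n : ℕ} {P F : Finset (Finset ℕ)}
    (hP : ∀ A ∈ P, A ⊆ Finset.Icc 1 p) (hF : InducedSaturated n P F) :
    InducedSaturated n (P.image fun A => Finset.Icc 1 p \ A)
      (F.image fun A => Finset.Icc 1 n \ A) := by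
  have sub : ∀ (U : Finset ℕ) (Q : Finset (Finset ℕ)),
      ∀ A ∈ Q.image (fun A => U \ A), A ⊆ U := by
    intro U Q A hA
    obtain ⟨A, hA, rfl⟩ := Finset.mem_image.1 hA
    exact Finset.sdiff_subset
  refine ⟨sub _ _, ?_, ?_⟩
  · intro h
    have := contains_compl (sub _ _) (sub _ _) h
    rw [compl_image_image hP, compl_image_image hF.1] at this
    exact hF.2.1 this
  · intro S hS hSF
    have h1 : Finset.Icc 1 n \ S ∉ F := fun h => hSF
      (Finset.mem_image.2 ⟨_, h, Finset.sdiff_sdiff_eq_self hS⟩)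
    have h2 := contains_compl hP (V := Finset.Icc 1 n) (by
      intro A hA
      rcases Finset.mem_insert.1 hA with rfl | hA
      · exact Finset.sdiff_subset
      · exact hF.1 A hA) (hF.2.2 _ Finset.sdiff_subset h1)
    rwa [Finset.image_insert, Finset.sdiff_sdiff_eq_self hS] at h2

/-- An element strictly above another element of `P` is not a leg. -/
theorem not_leg {P : Finset (Finset ℕ)} {L1 L2 H T A : Finset ℕ} (hL : LegsAt P L1 L2 H)
    (hT : T ∈ P) (hTA : T ⊆ A) (hne : T ≠ A) : A ≠ L1 ∧ A ≠ L2 := by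
  have hip := @hip_le P L1 L2 H T hL hT
  obtain ⟨m1, m2, mH, n12, n1H, n2H, s12, s21, s1H, s2H, -⟩ := hL
  constructor
  · rintro rfl
    have : T ≠ L2 := by rintro rfl; exact s21 hTA
    exact s21 (s2H.trans ((hip hne this).trans hTA))
  · rintro rfl
    have : T ≠ L1 := by rintro rfl; exact s12 hTA
    exact s12 (s1H.trans ((hip this hne).trans hTA))

/-- The arms of `P` (legs of the complement) are incomparable elements that are not legs. -/
theorem exists_arms {U : Finset ℕ} {P : Finset (Finset ℕ)} {L1 L2 H K1 K2 T : Finset ℕ}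
    (hP : ∀ A ∈ P, A ⊆ U) (hL : LegsAt P L1 L2 H)
    (hK : LegsAt (P.image fun A => U \ A) K1 K2 T) :
    ∃ M1 ∈ P, ∃ M2 ∈ P, M1 ≠ L1 ∧ M1 ≠ L2 ∧ M2 ≠ L1 ∧ M2 ≠ L2 ∧ ¬ M1 ⊆ M2 ∧ ¬ M2 ⊆ M1 := by
  obtain ⟨m1, m2, mT, n12, n1T, n2T, s12, s21, s1T, s2T, -⟩ := hK
  obtain ⟨A1, hA1, rfl⟩ := Finset.mem_image.1 m1
  obtain ⟨A2, hA2, rfl⟩ := Finset.mem_image.1 m2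
  obtain ⟨B, hB, rfl⟩ := Finset.mem_image.1 mT
  rw [compl_sub_iff (hP _ hB)] at s1T s2T
  rw [compl_sub_iff (hP _ hA2)] at s12
  rw [compl_sub_iff (hP _ hA1)] at s21
  have h1 := not_leg hL hB s1T (by rintro rfl; exact n1T rfl)
  have h2 := not_leg hL hB s2T (by rintro rfl; exact n2T rfl)
  exact ⟨A1, hA1, A2, hA2, h1.1, h1.2, h2.1, h2.2, s21, s12⟩

/-- If `P` is a poset on `[p]` such that both `P` and `P̄ = {[p] \ F : F ∈ P}` have legs,
and `n ≥ 3`, then every induced `P`-saturated family `F ⊆ 2^[n]` has `|F| ≥ 2n + 2`. -/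
theorem double_legs_saturated_lower_bound (p : ℕ) (P : Finset (Finset ℕ))
    (hPsub : ∀ A ∈ P, A ⊆ Finset.Icc 1 p)
    (hP : HasLegs P) (hPbar : HasLegs (P.image fun A => Finset.Icc 1 p \ A))
    (n : ℕ) (hn : 3 ≤ n) (F : Finset (Finset ℕ))
    (hF : InducedSaturated n P F) : 2 * n + 2 ≤ F.card := by
  obtain ⟨L1, L2, H, hL⟩ := hP
  obtain ⟨K1, K2, T, hK⟩ := hPbar
  have hF' := saturated_compl hPsub hF
  have hsub' : ∀ A ∈ P.image (fun A => Finset.Icc 1 p \ A), A ⊆ Finset.Icc 1 p := by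
    intro A hA
    obtain ⟨A, hA, rfl⟩ := Finset.mem_image.1 hA
    exact Finset.sdiff_subset
  obtain ⟨M1, hM1, M2, hM2, a1, a2, a3, a4, a5, a6⟩ := exists_arms hPsub hL hK
  obtain ⟨N1, hN1, N2, hN2, b1, b2, b3, b4, b5, b6⟩ := exists_arms hsub' hK
    (by rw [compl_image_image hPsub]; exact hL)
  obtain ⟨G, hGF, hG, hGp⟩ := half_bound hL hF hM1 hM2 a1 a2 a3 a4 a5 a6
  obtain ⟨G', hGF', hG', hGp'⟩ := half_bound hK hF' hN1 hN2 b1 b2 b3 b4 b5 b6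
  set c : Finset ℕ → Finset ℕ := fun A => Finset.Icc 1 n \ A with hc
  have hGn : ∀ X ∈ G', X ⊆ Finset.Icc 1 n := fun X hX => hF'.1 X (hGF' hX)
  have hcard : (G'.image c).card = G'.card := by
    apply Finset.card_image_of_injOn
    intro A hA B hB h
    have h' : c (c A) = c (c B) := congrArg c h
    simpa only [hc, Finset.sdiff_sdiff_eq_self (hGn A hA),
      Finset.sdiff_sdiff_eq_self (hGn B hB)] using h'
  have hsubF : G'.image c ⊆ F := by
    rw [← compl_image_image hF.1]
    exact Finset.image_subset_image hGF'
  have hdisj : Disjoint G (G'.image c) := by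
    rw [Finset.disjoint_left]
    intro X hX hX'
    obtain ⟨Z, hZ, rfl⟩ := Finset.mem_image.1 hX'
    obtain ⟨p1, p2⟩ := hGp _ hX
    obtain ⟨q1, q2⟩ := hGp' _ hZ
    have hZn := hGn Z hZ
    have hZZ : Finset.Icc 1 n \ c Z = Z := Finset.sdiff_sdiff_eq_self hZn
    rcases p2 with p2 | ⟨Y1, hY1, Y2, hY2, s1, s2, n1, n2⟩
    · rcases q2 with q2 | ⟨Y1, hY1, Y2, hY2, s1, s2, n1, n2⟩
      · have h := Finset.card_sdiff_add_card_eq_card hZn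
        simp only [hc] at p2
        simp only [Nat.card_Icc] at h
        omega
      · obtain ⟨W1, hW1, rfl⟩ := Finset.mem_image.1 hY1
        obtain ⟨W2, hW2, rfl⟩ := Finset.mem_image.1 hY2
        rw [← hZZ] at s1 s2
        rw [compl_sub_iff (hF.1 _ hW1)] at s1
        rw [compl_sub_iff (hF.1 _ hW2)] at s2
        rw [compl_sub_iff (hF.1 _ hW2)] at n1
        rw [compl_sub_iff (hF.1 _ hW1)] at n2
        rcases p1 W1 hW1 W2 hW2 s1 s2 with h | h
        · exact n2 h
        · exact n1 h
    · have t1 : c Y1 ⊆ Z := by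
        rw [← hZZ]; exact Finset.sdiff_subset_sdiff subset_rfl s1
      have t2 : c Y2 ⊆ Z := by
        rw [← hZZ]; exact Finset.sdiff_subset_sdiff subset_rfl s2
      rcases q1 _ (Finset.mem_image_of_mem _ hY1) _ (Finset.mem_image_of_mem _ hY2) t1 t2 with
        h | h
      · exact n2 ((compl_sub_iff (hF.1 _ hY2)).1 h)
      · exact n1 ((compl_sub_iff (hF.1 _ hY1)).1 h)
  have := Finset.card_le_card (Finset.union_subset hGF hsubF)
  rw [Finset.card_union_of_disjoint hdisj, hcard] at this
  omega
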